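/- arXiv:1902.01442 — 6 statements merged into one kernel-verified Lean document; each statement's English description precedes it below -/
import Mathlib

section
/- Fix v > 0 and let G₀(t) = ( ∫_0^{4v} e^{−xt} ρ_w(x) dx )², where ρ_w is the Marčenko–Pastur density with parameter v. Then the spectral gap closes and the form factor decays as a power law: lim_{t→∞} t · G₀(t) = 1/(πv). -/
open Filter Real

/-- The Marčenko–Pastur density `ρ_w(x) = (1/(2πv))√(4v/x − 1)` on `(0, 4v]`. -/
noncomputable def mpDensity (v x : ℝ) : ℝ := (1 / (2 * π * v)) * Real.sqrt (4 * v / x - 1)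

open MeasureTheory in
lemma mp_aux_limit_eq (v : ℝ) (hv : 0 < v) (u : ℝ) (hu : 0 < u) :
    Real.exp (-u) * Real.sqrt (4 * v / u) =
      (2 * Real.sqrt v) * (Real.exp (-u) * u ^ ((1 / 2 : ℝ) - 1)) := by
  have h1 : u ^ ((1 / 2 : ℝ) - 1) = (Real.sqrt u)⁻¹ := by
    rw [Real.sqrt_eq_rpow, ← Real.rpow_neg hu.le]
    norm_num
  have h2 : Real.sqrt (4 * v / u) = 2 * Real.sqrt v * (Real.sqrt u)⁻¹ := by
    rw [Real.sqrt_div (by positivity), Real.sqrt_mul (by norm_num),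
      show (4 : ℝ) = 2 ^ 2 by norm_num, Real.sqrt_sq (by norm_num), div_eq_mul_inv]
  rw [h1, h2]
  ring

open MeasureTheory in
lemma mp_aux_tendsto (v : ℝ) (hv : 0 < v) :
    Tendsto (fun t : ℝ => ∫ u in Set.Ioi (0 : ℝ), Real.exp (-u) * Real.sqrt (4 * v / u - 1 / t))
      atTop (nhds (2 * Real.sqrt v * Real.sqrt π)) := by
  have hJ : ∫ u in Set.Ioi (0 : ℝ), Real.exp (-u) * Real.sqrt (4 * v / u)
      = 2 * Real.sqrt v * Real.sqrt π := by
    rw [setIntegral_congr_fun measurableSet_Ioi (fun u hu => mp_aux_limit_eq v hv u hu),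
      integral_const_mul, ← Real.Gamma_eq_integral (by norm_num), Real.Gamma_one_half_eq]
  rw [← hJ]
  apply tendsto_integral_filter_of_dominated_convergence
    (fun u => Real.exp (-u) * Real.sqrt (4 * v / u))
  · exact Eventually.of_forall fun t => (by fun_prop : Measurable _).aestronglyMeasurable
  · filter_upwards [eventually_gt_atTop 0] with t ht
    refine Eventually.of_forall fun u => ?_
    rw [Real.norm_of_nonneg (by positivity)]
    have : 0 < 1 / t := by positivity
    gcongr
    linarith
  · have h := (Real.GammaIntegral_convergent (s := 1 / 2) (by norm_num)).const_mul
      (2 * Real.sqrt v)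
    refine IntegrableOn.congr_fun h (fun u hu => ?_) measurableSet_Ioi
    exact (mp_aux_limit_eq v hv u hu).symm
  · refine Eventually.of_forall fun u => ?_
    have h0 : Tendsto (fun t : ℝ => 4 * v / u - 1 / t) atTop (nhds (4 * v / u - 0)) := by
      refine tendsto_const_nhds.sub ?_
      exact tendsto_inv_atTop_zero.congr (fun t : ℝ => (one_div t).symm)
    rw [sub_zero] at h0
    exact (h0.sqrt).const_mul _

open MeasureTheory in
lemma mp_aux_subst (v : ℝ) (hv : 0 < v) (t : ℝ) (ht : 0 < t) :
    ∫ x in (0 : ℝ)..(4 * v), Real.exp (-x * t) * mpDensity v x =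
      t⁻¹ * ((1 / (2 * π * v) * Real.sqrt t) *
        ∫ u in Set.Ioi (0 : ℝ), Real.exp (-u) * Real.sqrt (4 * v / u - 1 / t)) := by
  rw [intervalIntegral.integral_of_le (by positivity)]
  have h1 : ∫ x in Set.Ioi (0 : ℝ), Real.exp (-x * t) * mpDensity v x =
      ∫ x in Set.Ioc (0 : ℝ) (4 * v), Real.exp (-x * t) * mpDensity v x := by
    apply setIntegral_eq_of_subset_of_forall_sdiff_eq_zero measurableSet_Ioi
      Set.Ioc_subset_Ioi_self
    rintro x ⟨hx, hx'⟩
    have hx0 : 0 < x := hx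
    have hx1 : 4 * v < x := by
      by_contra! h
      exact hx' ⟨hx0, h⟩
    have : 4 * v / x ≤ 1 := (div_le_one hx0).2 hx1.le
    rw [mpDensity, Real.sqrt_eq_zero_of_nonpos (by linarith)]
    simp
  have h2 := integral_comp_mul_left_Ioi (fun u => (1 / (2 * π * v) * Real.sqrt t) *
    (Real.exp (-u) * Real.sqrt (4 * v / u - 1 / t))) 0 ht
  rw [mul_zero, smul_eq_mul] at h2
  rw [← h1, ← integral_const_mul, ← h2]
  refine setIntegral_congr_fun measurableSet_Ioi (fun x hx => ?_)
  have hx0 : 0 < x := hx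
  have h3 : Real.sqrt (4 * v / x - 1) = Real.sqrt t * Real.sqrt (4 * v / (t * x) - 1 / t) := by
    rw [← Real.sqrt_mul ht.le]
    congr 1
    field_simp
  simp only [mpDensity]
  rw [h3, show -x * t = -(t * x) by ring]
  ring

/-- the leading-order form factor
`G₀(t) = (∫₀^{4v} e^{−xt} ρ_w(x) dx)²` decays as a power law: `t·G₀(t) → 1/(πv)`. -/
theorem mp_form_factor_power_law (v : ℝ) (hv : 0 < v) :
    Tendsto
      (fun t : ℝ => t * (∫ x in (0 : ℝ)..(4 * v), Real.exp (-x * t) * mpDensity v x) ^ 2)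
      atTop (nhds (1 / (π * v))) := by
  have h := ((mp_aux_tendsto v hv).const_mul (1 / (2 * π * v))).pow 2
  have hlim : (1 / (2 * π * v) * (2 * Real.sqrt v * Real.sqrt π)) ^ 2 = 1 / (π * v) := by
    have hpi := Real.pi_pos
    rw [mul_pow, mul_pow, mul_pow, Real.sq_sqrt hv.le, Real.sq_sqrt hpi.le]
    field_simp
  rw [hlim] at h
  refine h.congr' ?_
  filter_upwards [eventually_gt_atTop 0] with t ht
  rw [mp_aux_subst v hv t ht]
  simp only [mul_pow, Real.sq_sqrt ht.le]
  field_simp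
end

section
/- Fix v > 0. For every integer n ≥ 0, the n-th moment of the Marčenko–Pastur density is ∫_0^{4v} xⁿ ρ_w(x) dx = (2(4v)ⁿ/π) B(n + 1/2, 3/2) = vⁿ · (2n)!/(n!(n+1)!), i.e. vⁿ times the n-th Catalan number, where B is the Euler Beta function. -/
open Real

/-- The Euler Beta function `B(x,y) = Γ(x)Γ(y)/Γ(x+y)`. -/
noncomputable def eulerBeta (x y : ℝ) : ℝ := Real.Gamma x * Real.Gamma y / Real.Gamma (x + y)

theorem mp_beta_aux (n : ℕ) :
    (∫ t in (0 : ℝ)..1, t ^ n * Real.sqrt (1 / t - 1)) = eulerBeta ((n : ℝ) + 1 / 2) (3 / 2) := by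
  have h := Complex.betaIntegral_eq_Gamma_mul_div (((n : ℝ) + 1 / 2 : ℝ) : ℂ) ((3 / 2 : ℝ) : ℂ)
    (by rw [Complex.ofReal_re]; positivity) (by rw [Complex.ofReal_re]; positivity)
  rw [← Complex.ofReal_add, Complex.Gamma_ofReal, Complex.Gamma_ofReal, Complex.Gamma_ofReal] at h
  have h2 : Complex.betaIntegral (((n : ℝ) + 1 / 2 : ℝ) : ℂ) ((3 / 2 : ℝ) : ℂ)
      = ((∫ t in (0 : ℝ)..1, t ^ n * Real.sqrt (1 / t - 1) : ℝ) : ℂ) := by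
    rw [Complex.betaIntegral, ← intervalIntegral.integral_ofReal]
    apply intervalIntegral.integral_congr_ae
    refine Filter.Eventually.of_forall fun t ht => ?_
    rw [Set.uIoc_of_le zero_le_one] at ht
    obtain ⟨h0, h1⟩ := ht
    have e1 : (1 : ℂ) - t = ((1 - t : ℝ) : ℂ) := by push_cast; rfl
    have e2 : ((((n : ℝ) + 1 / 2 : ℝ) : ℂ) - 1) = (((n : ℝ) - 1 / 2 : ℝ) : ℂ) := by
      push_cast; ring
    have e3 : (((3 / 2 : ℝ) : ℂ) - 1) = ((1 / 2 : ℝ) : ℂ) := by push_cast; norm_num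
    rw [e1, e2, e3, ← Complex.ofReal_cpow h0.le, ← Complex.ofReal_cpow (by linarith),
      ← Complex.ofReal_mul]
    congr 1
    rw [Real.rpow_sub h0, Real.rpow_natCast, ← Real.sqrt_eq_rpow, ← Real.sqrt_eq_rpow]
    have : 1 / t - 1 = (1 - t) / t := by field_simp
    rw [this, Real.sqrt_div (by linarith)]
    ring
  rw [h2] at h
  rw [eulerBeta]
  exact_mod_cast h

theorem mp_gamma_aux (n : ℕ) : (2 / π) * 4 ^ n * eulerBeta ((n : ℝ) + 1 / 2) (3 / 2)
    = (Nat.factorial (2 * n) : ℝ) / ((Nat.factorial n : ℝ) * (Nat.factorial (n + 1) : ℝ)) := by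
  have hg : Real.Gamma (3 / 2) = 1 / 2 * √π := by
    rw [← Real.Gamma_one_half_eq, ← Real.Gamma_add_one (by norm_num)]; norm_num
  have hs : √π * √π = π := Real.mul_self_sqrt Real.pi_pos.le
  have hp := Real.pi_pos
  have hn : Real.Gamma ((n : ℝ) + 1 / 2) * (4 ^ n * (Nat.factorial n : ℝ))
      = (Nat.factorial (2 * n) : ℝ) * √π := by
    induction n with
    | zero => simp [-one_div, Real.Gamma_one_half_eq]
    | succ k ih =>
      have e : ((k + 1 : ℕ) : ℝ) + 1 / 2 = ((k : ℝ) + 1 / 2) + 1 := by push_cast; ring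
      rw [e, Real.Gamma_add_one (by positivity), show 2 * (k + 1) = 2 * k + 1 + 1 by ring,
        Nat.factorial_succ, Nat.factorial_succ, Nat.factorial_succ, pow_succ]
      push_cast
      linear_combination (4 * ((k : ℝ) + 1 / 2) * (k + 1)) * ih
  have hd : Real.Gamma ((n : ℝ) + 1 / 2 + 3 / 2) = (Nat.factorial (n + 1) : ℝ) := by
    rw [← Real.Gamma_nat_eq_factorial]; congr 1; push_cast; ring
  rw [eulerBeta, hd, hg]
  generalize Real.Gamma ((n : ℝ) + 1 / 2) = G at hn ⊢
  field_simp
  linear_combination √π * hn + (Nat.factorial (2 * n) : ℝ) * hs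

theorem mp_scale_aux (v : ℝ) (hv : 0 < v) (n : ℕ) :
    (∫ x in (0 : ℝ)..(4 * v), x ^ n * mpDensity v x)
        = (2 * (4 * v) ^ n / π) * eulerBeta ((n : ℝ) + 1 / 2) (3 / 2) := by
  have hp := Real.pi_pos
  have h := intervalIntegral.smul_integral_comp_mul_left (a := 0) (b := 1)
    (fun x => x ^ n * mpDensity v x) (4 * v)
  rw [mul_zero, mul_one] at h
  rw [← h, ← mp_beta_aux, smul_eq_mul, ← intervalIntegral.integral_const_mul,
    ← intervalIntegral.integral_const_mul]
  congr 1
  funext t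
  have : 4 * v / (4 * v * t) = 1 / t := by
    rw [← div_div, div_self (by positivity)]
  rw [mpDensity, this, mul_pow]
  field_simp
  ring

/-- the `n`-th moment of the Marčenko–Pastur density equals
`(2(4v)ⁿ/π) B(n+1/2, 3/2) = vⁿ (2n)!/(n!(n+1)!)`, i.e. `vⁿ` times the `n`-th Catalan
number. -/
theorem mp_moments (v : ℝ) (hv : 0 < v) (n : ℕ) :
    (∫ x in (0 : ℝ)..(4 * v), x ^ n * mpDensity v x)
        = (2 * (4 * v) ^ n / π) * eulerBeta ((n : ℝ) + 1 / 2) (3 / 2) ∧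
    (∫ x in (0 : ℝ)..(4 * v), x ^ n * mpDensity v x)
        = v ^ n * ((Nat.factorial (2 * n) : ℝ)
            / ((Nat.factorial n : ℝ) * (Nat.factorial (n + 1) : ℝ))) ∧
    (∫ x in (0 : ℝ)..(4 * v), x ^ n * mpDensity v x) = v ^ n * (catalan n : ℝ) := by
  have h1 := mp_scale_aux v hv n
  have h2 : (∫ x in (0 : ℝ)..(4 * v), x ^ n * mpDensity v x)
        = v ^ n * ((Nat.factorial (2 * n) : ℝ)
            / ((Nat.factorial n : ℝ) * (Nat.factorial (n + 1) : ℝ))) := by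
    rw [h1, ← mp_gamma_aux, mul_pow]; ring
  refine ⟨h1, h2, ?_⟩
  rw [h2]
  congr 1
  have hc : ((n + 1 : ℕ) : ℝ) * catalan n = (Nat.centralBinom n : ℝ) := by
    exact_mod_cast succ_mul_catalan_eq_centralBinom n
  have hb : (Nat.centralBinom n : ℝ) * (Nat.factorial n) * (Nat.factorial n)
      = Nat.factorial (2 * n) := by
    have := Nat.choose_mul_factorial_mul_factorial (show n ≤ 2 * n by omega)
    rw [show 2 * n - n = n by omega] at this
    rw [Nat.centralBinom]
    exact_mod_cast this
  rw [div_eq_iff (by positivity), Nat.factorial_succ, ← hb, ← hc]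
  push_cast
  ring
end

section
/- Fix v > 0 and let z be a real number with z > 4v. Then the Stieltjes transform of the Marčenko–Pastur density is ∫_0^{4v} ρ_w(x)/(z − x) dx = 1/(2v) − √(z² − 4vz)/(2vz). -/
open Real

lemma hasDerivAt_arcsin_sqrt_aux {q : ℝ → ℝ} {q' x : ℝ} (h : HasDerivAt q q' x)
    (h0 : 0 < q x) (h1 : q x < 1) :
    HasDerivAt (fun y => Real.arcsin (√(q y))) (q' / (2 * √(q x * (1 - q x)))) x := by
  have hs : √(q x) < 1 := by
    rw [Real.sqrt_lt' one_pos]; simpa using h1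
  have hp : 0 < √(q x) := Real.sqrt_pos.2 h0
  have := (Real.hasDerivAt_arcsin (x := √(q x)) (by linarith) hs.ne).comp x (h.sqrt h0.ne')
  refine this.congr_deriv ?_
  rw [Real.sq_sqrt h0.le, Real.sqrt_mul h0.le]
  have : 0 < √(1 - q x) := Real.sqrt_pos.2 (by linarith)
  field_simp

theorem mp_stieltjes_transform (v z : ℝ) (hv : 0 < v) (hz : 4 * v < z) :
    (∫ x in (0 : ℝ)..(4 * v), mpDensity v x / (z - x))
      = 1 / (2 * v) - Real.sqrt (z ^ 2 - 4 * v * z) / (2 * v * z) := by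
  obtain ⟨w, rfl⟩ : ∃ w, z = w + 4 * v := ⟨z - 4 * v, by ring⟩
  have hw : 0 < w := by linarith
  set z := w + 4 * v with hzdef
  have hz0 : 0 < z := by positivity
  set R := √(w * z) with hR
  have hR0 : 0 < R := Real.sqrt_pos.2 (by positivity)
  have hRR : R ^ 2 = w * z := Real.sq_sqrt (by positivity)
  have hRz : √(z ^ 2 - 4 * v * z) = R := by
    rw [hR]; congr 1; rw [hzdef]; ring
  let F : ℝ → ℝ := fun x => 2 * Real.arcsin (√(x / (4 * v)))
    - 2 * (R / z) * Real.arcsin (√(w * x / (4 * v * (z - x))))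
  have hcont : ContinuousOn F (Set.Icc 0 (4 * v)) := by
    have h2 : ContinuousOn (fun x => w * x / (4 * v * (z - x))) (Set.Icc 0 (4 * v)) := by
      apply ContinuousOn.div (by fun_prop) (by fun_prop)
      intro x hx
      have : 0 < z - x := by linarith [hx.2]
      positivity
    have h3 := Real.continuous_arcsin.comp_continuousOn h2.sqrt
    have h1 : Continuous (fun x => 2 * Real.arcsin (√(x / (4 * v)))) := by
      have := Real.continuous_arcsin
      fun_prop
    exact h1.continuousOn.sub (continuousOn_const.mul h3)
  have hderiv : ∀ x ∈ Set.Ioo 0 (4 * v), HasDerivAt F (√(4 * v / x - 1) / (z - x)) x := by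
    rintro x ⟨hx0, hx1⟩
    have hzx : 0 < z - x := by linarith
    have hvx : 0 < 4 * v - x := by linarith
    have d1 : HasDerivAt (fun x : ℝ => x / (4 * v)) (1 / (4 * v)) x :=
      (hasDerivAt_id x).div_const _
    have d2 : HasDerivAt (fun x : ℝ => w * x / (4 * v * (z - x)))
        (w * z / (4 * v * (z - x) ^ 2)) x := by
      refine (((hasDerivAt_id x).const_mul w).div
        (((hasDerivAt_id x).const_sub z).const_mul (4 * v)) (by simp; constructor <;> linarith)).congr_deriv ?_
      simp only [id]
      field_simp
      ring
    have e1 := hasDerivAt_arcsin_sqrt_aux d1 (by positivity)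
      (by rw [div_lt_one (by positivity)]; exact hx1)
    have e2 := hasDerivAt_arcsin_sqrt_aux d2 (by positivity)
      (by rw [div_lt_one (by positivity)]; rw [hzdef]; nlinarith [mul_pos (by positivity : 0 < w + 4 * v) hvx])
    refine ((e1.const_mul 2).sub (e2.const_mul (2 * (R / z)))).congr_deriv ?_
    set S := √(x * (4 * v - x)) with hS
    have hS0 : 0 < S := Real.sqrt_pos.2 (by positivity)
    have hSS : S ^ 2 = x * (4 * v - x) := Real.sq_sqrt (by positivity)
    have s1 : √(x / (4 * v) * (1 - x / (4 * v))) = S / (4 * v) := by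
      rw [Real.sqrt_eq_iff_mul_self_eq_of_pos (by positivity)]
      field_simp
      rw [hSS]
    have s2 : √(w * x / (4 * v * (z - x)) * (1 - w * x / (4 * v * (z - x))))
        = R * S / (4 * v * (z - x)) := by
      rw [Real.sqrt_eq_iff_mul_self_eq_of_pos (by positivity)]
      field_simp
      rw [hSS, hRR, hzdef]; ring
    have s3 : √(4 * v / x - 1) = S / x := by
      rw [Real.sqrt_eq_iff_mul_self_eq_of_pos (by positivity)]
      field_simp
      rw [hSS]
    rw [s1, s2, s3]
    field_simp
    rw [hSS, hzdef]; ring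
  have hint : IntervalIntegrable (fun x => √(4 * v / x - 1) / (z - x)) MeasureTheory.volume 0 (4 * v) := by
    apply intervalIntegral.intervalIntegrable_deriv_of_nonneg (g := F)
    · rwa [Set.uIcc_of_le (by positivity)]
    · rwa [min_eq_left (by positivity), max_eq_right (by positivity)]
    · rw [min_eq_left (by positivity), max_eq_right (by positivity)]
      intro x hx
      have : 0 < z - x := by linarith [hx.2]
      positivity
  have key := intervalIntegral.integral_eq_sub_of_hasDerivAt_of_le (by positivity) hcont hderiv hint
  have hF0 : F 0 = 0 := by simp [F]
  have hF1 : F (4 * v) = π - R / z * π := by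
    have a1 : 4 * v / (4 * v) = 1 := div_self (by positivity)
    have a2 : w * (4 * v) / (4 * v * (z - 4 * v)) = 1 := by
      have : z - 4 * v = w := by rw [hzdef]; ring
      rw [this]; field_simp
    simp only [F, a1, a2, Real.sqrt_one, Real.arcsin_one]
    ring
  simp only [mpDensity, mul_div_assoc]
  rw [intervalIntegral.integral_const_mul]
  simp only [← mul_div_assoc]
  rw [key, hF0, hF1, hRz]
  have := Real.pi_pos
  field_simp
  ring
end

section
/- Fix v > 0. For every integer k ≥ 0, the double semicircle moment integral evaluates to ∫∫ ρ_sc(x) ρ_sc(y) (x − y)^{2k} dx dy = v^k · 4^{2k+1} Γ(k + 1/2) Γ(k + 3/2) / (π Γ(k + 2) Γ(k + 3)), where both integrals run over [−2√v, 2√v] and Γ is the Gamma function. -/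
open Real

/-- The semicircle density `ρ_sc(x) = (1/(2πv))√(4v − x²)` on `[−2√v, 2√v]`. -/
noncomputable def scDensity (v x : ℝ) : ℝ := (1 / (2 * π * v)) * Real.sqrt (4 * v - x ^ 2)

noncomputable def scMom (v : ℝ) (n : ℕ) : ℝ :=
  ∫ x in (-(2 * Real.sqrt v))..(2 * Real.sqrt v), scDensity v x * x ^ n

lemma scDensity_cont (v : ℝ) : Continuous (scDensity v) := by
  unfold scDensity; fun_prop

lemma scMom_rec (v : ℝ) (hv : 0 < v) (n : ℕ) :
    ((n : ℝ) + 4) * scMom v (n + 2) = 4 * v * (n + 1) * scMom v n := by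
  have hs : 0 < Real.sqrt v := Real.sqrt_pos.2 hv
  have hsq : Real.sqrt v ^ 2 = v := Real.sq_sqrt hv.le
  have hc := scDensity_cont v
  have key := intervalIntegral.integral_eq_sub_of_hasDerivAt_of_le
    (a := -(2 * Real.sqrt v)) (b := 2 * Real.sqrt v)
    (f := fun x => x ^ (n + 1) * (4 * v - x ^ 2) * scDensity v x)
    (f' := fun x => 4 * v * (n + 1) * (scDensity v x * x ^ n)
      - (n + 4) * (scDensity v x * x ^ (n + 2)))
    (by linarith) (by fun_prop) ?_ ?_
  · rw [intervalIntegral.integral_sub (Continuous.intervalIntegrable (by fun_prop) _ _)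
      (Continuous.intervalIntegrable (by fun_prop) _ _),
      intervalIntegral.integral_const_mul, intervalIntegral.integral_const_mul] at key
    have h1 : 4 * v - (2 * Real.sqrt v) ^ 2 = 0 := by rw [mul_pow, hsq]; ring
    have h2 : 4 * v - (-(2 * Real.sqrt v)) ^ 2 = 0 := by rw [neg_sq, h1]
    simp only [h1, h2] at key
    unfold scMom
    linarith
  · intro x hx
    have hpos : 0 < 4 * v - x ^ 2 := by
      have : 0 < (2 * Real.sqrt v - x) * (2 * Real.sqrt v + x) :=
        mul_pos (by linarith [hx.2]) (by linarith [hx.1])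
      nlinarith
    have hd : HasDerivAt (fun x : ℝ => 4 * v - x ^ 2) (-(2 * x)) x := by
      simpa using (hasDerivAt_pow 2 x).const_sub (4 * v)
    have hd2 := (hd.sqrt hpos.ne').const_mul (1 / (2 * π * v))
    have hd3 := ((hasDerivAt_pow (n + 1) x).mul hd).mul hd2
    refine hd3.congr_deriv ?_
    have hq : Real.sqrt (4 * v - x ^ 2) ≠ 0 := (Real.sqrt_pos.2 hpos).ne'
    have hq2 : Real.sqrt (4 * v - x ^ 2) ^ 2 = 4 * v - x ^ 2 := Real.sq_sqrt hpos.le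
    simp only [scDensity, Nat.add_sub_cancel, Pi.mul_apply]
    generalize Real.sqrt (4 * v - x ^ 2) = q at *
    rw [← hq2]
    have hv' : v = (q ^ 2 + x ^ 2) / 4 := by linarith
    have hc : ∃ c, c = 1 / (2 * π * v) := ⟨_, rfl⟩
    obtain ⟨c, hc⟩ := hc
    rw [← hc]
    clear hc
    rw [hv']
    push_cast
    field_simp
    ring
  · exact Continuous.intervalIntegrable (by fun_prop) _ _

lemma scMom_odd (v : ℝ) (n : ℕ) (hn : Odd n) : scMom v n = 0 := by
  have h := intervalIntegral.integral_comp_neg (a := -(2 * Real.sqrt v)) (b := 2 * Real.sqrt v)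
    (fun x => scDensity v x * x ^ n)
  simp only [scDensity, neg_sq, hn.neg_pow, neg_neg, mul_neg, intervalIntegral.integral_neg] at h
  simp only [scMom, scDensity]
  linarith

lemma scMom_zero (v : ℝ) (hv : 0 < v) : scMom v 0 = 1 := by
  have hs : 0 < Real.sqrt v := Real.sqrt_pos.2 hv
  have hsq : Real.sqrt v ^ 2 = v := Real.sq_sqrt hv.le
  have h := intervalIntegral.mul_integral_comp_mul_left (a := -1) (b := 1)
    (f := fun x => scDensity v x * x ^ 0) (c := 2 * Real.sqrt v)
  simp only [mul_neg, mul_one] at h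
  simp only [scMom, mul_one, pow_zero] at h ⊢
  rw [← h]
  have : ∀ x : ℝ, scDensity v (2 * Real.sqrt v * x)
      = (1 / (2 * π * v) * (2 * Real.sqrt v)) * Real.sqrt (1 - x ^ 2) := by
    intro x
    unfold scDensity
    have : 4 * v - (2 * Real.sqrt v * x) ^ 2 = (2 * Real.sqrt v) ^ 2 * (1 - x ^ 2) := by
      rw [mul_pow, mul_pow, hsq]; ring
    rw [this, Real.sqrt_mul (by positivity), Real.sqrt_sq (by positivity)]
    ring
  simp only [this]
  rw [intervalIntegral.integral_const_mul, integral_sqrt_one_sub_sq]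
  have := Real.pi_pos
  field_simp
  rw [hsq]
  try ring

lemma scMom_even (v : ℝ) (hv : 0 < v) (j : ℕ) :
    scMom v (2 * j) = v ^ j * ((2 * j).factorial / (j.factorial * (j + 1).factorial)) := by
  induction j with
  | zero => simp [scMom_zero v hv]
  | succ j ih =>
    have h := scMom_rec v hv (2 * j)
    rw [ih] at h
    have e : 2 * (j + 1) = 2 * j + 2 := by ring
    rw [e]
    have h4 : ((2 * j : ℕ) : ℝ) + 4 ≠ 0 := by positivity
    apply mul_left_cancel₀ h4
    rw [h]
    simp only [Nat.factorial_succ]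
    push_cast
    have := Nat.factorial_ne_zero j
    field_simp
    ring

lemma sum_even_aux (f : ℕ → ℝ) (hf : ∀ n, Odd n → f n = 0) (k : ℕ) :
    ∑ m ∈ Finset.range (2 * k + 1), f m = ∑ j ∈ Finset.range (k + 1), f (2 * j) := by
  induction k with
  | zero => simp
  | succ k ih =>
    rw [Finset.sum_range_succ _ (k + 1), ← ih,
      show 2 * (k + 1) + 1 = 2 * k + 1 + 1 + 1 by ring, Finset.sum_range_succ,
      Finset.sum_range_succ, hf (2 * k + 1) ⟨k, rfl⟩]
    simp [mul_add]

lemma vander (k : ℕ) : ∑ j ∈ Finset.range (k + 1), ((k + 1).choose j * (k + 1).choose (k - j) : ℝ)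
    = (2 * k + 2).choose k := by
  have h := Nat.add_choose_eq (k + 1) (k + 1) k
  rw [Finset.Nat.sum_antidiagonal_eq_sum_range_succ_mk] at h
  rw [show 2 * k + 2 = k + 1 + (k + 1) by ring, h]
  push_cast
  rfl

lemma gamma_half (k : ℕ) :
    Real.Gamma ((k : ℝ) + 1 / 2) = (2 * k).factorial * √π / (4 ^ k * k.factorial) := by
  induction k with
  | zero => simp [-one_div, Real.Gamma_one_half_eq]
  | succ k ih =>
    have : ((k + 1 : ℕ) : ℝ) + 1 / 2 = ((k : ℝ) + 1 / 2) + 1 := by push_cast; ring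
    rw [this, Real.Gamma_add_one (by positivity), ih]
    simp only [Nat.factorial_succ, mul_add, mul_one]
    push_cast
    have := Nat.factorial_ne_zero k
    field_simp
    ring

lemma scMom_double (v : ℝ) (k : ℕ) :
    (∫ x in (-(2 * Real.sqrt v))..(2 * Real.sqrt v),
      ∫ y in (-(2 * Real.sqrt v))..(2 * Real.sqrt v),
        scDensity v x * scDensity v y * (x - y) ^ (2 * k))
      = ∑ m ∈ Finset.range (2 * k + 1),
        (-1) ^ (2 * k - m) * ((2 * k).choose m : ℝ) * scMom v m * scMom v (2 * k - m) := by
  have hc := scDensity_cont v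
  have h1 : ∀ x y : ℝ, scDensity v x * scDensity v y * (x - y) ^ (2 * k)
      = ∑ m ∈ Finset.range (2 * k + 1), ((-1) ^ (2 * k - m) * ((2 * k).choose m : ℝ) *
        (scDensity v x * x ^ m)) * (scDensity v y * y ^ (2 * k - m)) := by
    intro x y
    rw [sub_eq_add_neg, add_pow, Finset.mul_sum]
    refine Finset.sum_congr rfl fun m _ => ?_
    rw [neg_pow y]
    ring
  simp only [h1]
  have h2 : ∀ x : ℝ, (∫ y in (-(2 * Real.sqrt v))..(2 * Real.sqrt v),
      ∑ m ∈ Finset.range (2 * k + 1), ((-1) ^ (2 * k - m) * ((2 * k).choose m : ℝ) *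
        (scDensity v x * x ^ m)) * (scDensity v y * y ^ (2 * k - m)))
      = ∑ m ∈ Finset.range (2 * k + 1), ((-1) ^ (2 * k - m) * ((2 * k).choose m : ℝ) *
        scMom v (2 * k - m)) * (scDensity v x * x ^ m) := by
    intro x
    rw [intervalIntegral.integral_finsetSum
      (fun m _ => Continuous.intervalIntegrable (by fun_prop) _ _)]
    refine Finset.sum_congr rfl fun m _ => ?_
    rw [intervalIntegral.integral_const_mul, ← scMom]
    ring
  simp only [h2]
  rw [intervalIntegral.integral_finsetSum
      (fun m _ => Continuous.intervalIntegrable (by fun_prop) _ _)]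
  refine Finset.sum_congr rfl fun m _ => ?_
  rw [intervalIntegral.integral_const_mul, ← scMom]
  ring

/-- the double semicircle moment integral
`∫∫ ρ_sc(x) ρ_sc(y) (x − y)^{2k} dx dy` over `[−2√v, 2√v]²` equals
`v^k 4^{2k+1} Γ(k+1/2)Γ(k+3/2)/(π Γ(k+2)Γ(k+3))`. -/
theorem semicircle_double_moments (v : ℝ) (hv : 0 < v) (k : ℕ) :
    (∫ x in (-(2 * Real.sqrt v))..(2 * Real.sqrt v),
      ∫ y in (-(2 * Real.sqrt v))..(2 * Real.sqrt v),
        scDensity v x * scDensity v y * (x - y) ^ (2 * k))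
      = v ^ k * 4 ^ (2 * k + 1) * Real.Gamma ((k : ℝ) + 1 / 2) * Real.Gamma ((k : ℝ) + 3 / 2)
          / (π * Real.Gamma ((k : ℝ) + 2) * Real.Gamma ((k : ℝ) + 3)) := by
  rw [scMom_double, sum_even_aux _ (fun n hn => by rw [scMom_odd v n hn]; ring)]
  have hterm : ∀ j ∈ Finset.range (k + 1),
      (-1) ^ (2 * k - 2 * j) * ((2 * k).choose (2 * j) : ℝ) * scMom v (2 * j)
        * scMom v (2 * k - 2 * j)
      = v ^ k * ((2 * k).factorial / (k + 1).factorial ^ 2) *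
        ((k + 1).choose j * (k + 1).choose (k - j)) := by
    intro j hj
    obtain ⟨i, rfl⟩ := Nat.exists_eq_add_of_le (Nat.lt_succ_iff.1 (Finset.mem_range.1 hj))
    rw [show 2 * (j + i) - 2 * j = 2 * i by omega, show j + i - j = i by omega,
      scMom_even v hv, scMom_even v hv, pow_mul, neg_one_sq, one_pow,
      Nat.cast_choose ℝ (show 2 * j ≤ 2 * (j + i) by omega),
      Nat.cast_choose ℝ (show j ≤ j + i + 1 by omega),
      Nat.cast_choose ℝ (show i ≤ j + i + 1 by omega),
      show 2 * (j + i) - 2 * j = 2 * i by omega, show j + i + 1 - j = i + 1 by omega,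
      show j + i + 1 - i = j + 1 by omega]
    have h1 := Nat.factorial_ne_zero j
    have h2 := Nat.factorial_ne_zero i
    have h3 := Nat.factorial_ne_zero (2 * j)
    have h4 := Nat.factorial_ne_zero (2 * i)
    have h5 := Nat.factorial_ne_zero (j + i + 1)
    have h6 := Nat.factorial_ne_zero (j + 1)
    have h7 := Nat.factorial_ne_zero (i + 1)
    field_simp
    try ring
  rw [Finset.sum_congr rfl hterm, ← Finset.mul_sum, vander,
    show (k : ℝ) + 3 / 2 = ((k + 1 : ℕ) : ℝ) + 1 / 2 by push_cast; ring,
    gamma_half, gamma_half,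
    show (k : ℝ) + 2 = ((k + 1 : ℕ) : ℝ) + 1 by push_cast; ring,
    show (k : ℝ) + 3 = ((k + 2 : ℕ) : ℝ) + 1 by push_cast; ring,
    Real.Gamma_nat_eq_factorial, Real.Gamma_nat_eq_factorial,
    Nat.cast_choose ℝ (show k ≤ 2 * k + 2 by omega),
    show 2 * k + 2 - k = k + 2 by omega, show 2 * (k + 1) = 2 * k + 2 by ring]
  have h1 := Nat.factorial_ne_zero k
  have h2 := Nat.factorial_ne_zero (k + 1)
  have h3 := Nat.factorial_ne_zero (k + 2)
  have hp := Real.pi_pos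
  have hpi : √π ^ 2 = π := Real.sq_sqrt hp.le
  field_simp
  rw [hpi]
  ring
end

section
/- (Multiple jump operators: exponential relaxation with t^{−3} prefactor.) Fix an integer m ≥ 2 and v > 0, and let ξ_± = (1 ± √m)². Let ψ(t) = ∫_{ξ_−}^{ξ_+} (1/(2πξ))√((ξ_+ − ξ)(ξ − ξ_−)) e^{−vtξ} dξ, so that ψ(t)² is the leading-order dissipative form factor for a dissipator with m independent complex Ginibre jump operators of equal variance. Then lim_{t→∞} t³ e^{2vξ_− t} ψ(t)² = √m / (4π v³ ξ_−²). In particular the asymptotic decay rate is 2v(1 − √m)². -/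
open Real Filter

lemma laplace_limit (a b v : ℝ) (ha : 0 < a) (hab : a < b) (hv : 0 < v) :
    Tendsto (fun t : ℝ => ∫ s in Set.Ioi (0:ℝ),
      1 / (2 * π * (a + s / t)) * Real.sqrt ((b - (a + s / t)) * s) * Real.exp (-(v * s)))
      atTop (nhds (∫ s in Set.Ioi (0:ℝ),
        1 / (2 * π * a) * Real.sqrt ((b - a) * s) * Real.exp (-(v * s)))) := by
  have hint : MeasureTheory.IntegrableOn (fun s : ℝ =>
      1 / (2 * π * a) * Real.sqrt ((b - a) * s) * Real.exp (-(v * s))) (Set.Ioi 0) := by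
    have h := integrableOn_rpow_mul_exp_neg_mul_rpow (p := 1) (s := 1/2) (b := v)
      (by norm_num) one_pos hv
    have h2 := h.const_mul (1 / (2 * π * a) * Real.sqrt (b - a))
    refine MeasureTheory.IntegrableOn.congr_fun h2 ?_ measurableSet_Ioi
    intro s hs
    simp only [Real.rpow_one, Real.sqrt_mul (sub_pos.2 hab).le, ← Real.sqrt_eq_rpow]
    ring_nf
  refine MeasureTheory.tendsto_integral_filter_of_dominated_convergence _ ?_ ?_ hint ?_
  · filter_upwards with t
    apply Measurable.aestronglyMeasurable
    fun_prop
  · filter_upwards [eventually_gt_atTop 0] with t ht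
    filter_upwards [MeasureTheory.ae_restrict_mem measurableSet_Ioi] with s hs
    have hs' : 0 < s := hs
    have hst : 0 < s / t := div_pos hs' ht
    have : 0 ≤ 1 / (2 * π * (a + s / t)) * Real.sqrt ((b - (a + s / t)) * s)
      * Real.exp (-(v * s)) := by positivity
    rw [Real.norm_of_nonneg this]
    gcongr
    · linarith
    · linarith
  · filter_upwards with s
    have h0 : Tendsto (fun t : ℝ => a + s / t) atTop (nhds a) := by
      simpa using (tendsto_const_nhds (x := a)).add ((tendsto_const_nhds (x := s)).div_atTop tendsto_id)
    refine Tendsto.mul (Tendsto.mul ?_ ?_) tendsto_const_nhds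
    · exact tendsto_const_nhds.div (tendsto_const_nhds.mul h0) (by positivity)
    · exact ((tendsto_const_nhds.sub h0).mul tendsto_const_nhds).sqrt

lemma laplace_value (a b v : ℝ) (hab : a < b) (hv : 0 < v) :
    (∫ s in Set.Ioi (0:ℝ),
        1 / (2 * π * a) * Real.sqrt ((b - a) * s) * Real.exp (-(v * s))) ^ 2
      = (b - a) / (16 * π * v ^ 3 * a ^ 2) := by
  have h1 : (∫ s in Set.Ioi (0:ℝ),
        1 / (2 * π * a) * Real.sqrt ((b - a) * s) * Real.exp (-(v * s)))
      = 1 / (2 * π * a) * Real.sqrt (b - a) * ((1 / v) ^ (3 / 2 : ℝ) * Real.Gamma (3 / 2)) := by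
    rw [← Real.integral_rpow_mul_exp_neg_mul_Ioi (by norm_num) hv,
      ← MeasureTheory.integral_const_mul]
    refine MeasureTheory.setIntegral_congr_fun measurableSet_Ioi ?_
    intro s hs
    simp only [Real.sqrt_mul (sub_pos.2 hab).le]
    rw [show (3 / 2 - 1 : ℝ) = 1 / 2 by norm_num, ← Real.sqrt_eq_rpow]
    ring
  have hG : Real.Gamma (3 / 2) = Real.sqrt π / 2 := by
    rw [show (3 / 2 : ℝ) = 1 / 2 + 1 by norm_num, Real.Gamma_add_one (by norm_num),
      Real.Gamma_one_half_eq]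
    ring
  have hp : ((1 / v) ^ (3 / 2 : ℝ)) ^ 2 = (1 / v) ^ 3 := by
    rw [← Real.rpow_natCast, ← Real.rpow_mul (by positivity), ← Real.rpow_natCast]
    norm_num
  rw [h1, hG, mul_pow, mul_pow, mul_pow, hp, Real.sq_sqrt (sub_pos.2 hab).le, div_pow (Real.sqrt π),
    Real.sq_sqrt pi_pos.le]
  field_simp
  ring

lemma laplace_subst (a b v t : ℝ) (hab : a < b) (ht : 0 < t) :
    t ^ 3 * Real.exp (2 * v * a * t) *
        (∫ ξ in a..b, (1 / (2 * π * ξ)) * Real.sqrt ((b - ξ) * (ξ - a)) *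
            Real.exp (-v * t * ξ)) ^ 2
      = (∫ s in Set.Ioi (0:ℝ),
      1 / (2 * π * (a + s / t)) * Real.sqrt ((b - (a + s / t)) * s) * Real.exp (-(v * s))) ^ 2 := by
  have h1 := intervalIntegral.integral_comp_add_div (a := 0) (b := t * (b - a)) (fun ξ : ℝ =>
    (1 / (2 * π * ξ)) * Real.sqrt ((b - ξ) * (ξ - a)) * Real.exp (-v * t * ξ)) ht.ne' a
  rw [show a + 0 / t = a by simp, show a + t * (b - a) / t = b by field_simp; ring,
    smul_eq_mul] at h1
  have h2 : (∫ s in (0:ℝ)..(t * (b - a)), 1 / (2 * π * (a + s / t)) *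
      Real.sqrt ((b - (a + s / t)) * (a + s / t - a)) * Real.exp (-v * t * (a + s / t)))
      = ((Real.sqrt t)⁻¹ * Real.exp (-(v * a * t))) * ∫ s in Set.Ioi (0:ℝ),
      1 / (2 * π * (a + s / t)) * Real.sqrt ((b - (a + s / t)) * s) * Real.exp (-(v * s)) := by
    have h3 : (∫ s in Set.Ioi (0:ℝ),
      1 / (2 * π * (a + s / t)) * Real.sqrt ((b - (a + s / t)) * s) * Real.exp (-(v * s)))
      = ∫ s in (0:ℝ)..(t * (b - a)),
      1 / (2 * π * (a + s / t)) * Real.sqrt ((b - (a + s / t)) * s) * Real.exp (-(v * s)) := by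
      rw [intervalIntegral.integral_of_le (mul_pos ht (sub_pos.2 hab)).le]
      refine (MeasureTheory.setIntegral_eq_of_subset_of_forall_sdiff_eq_zero measurableSet_Ioi
        (fun x hx => hx.1) ?_)
      intro s hs
      have hs0 : 0 < s := hs.1
      have hs1 : t * (b - a) < s := by
        by_contra h
        exact hs.2 ⟨hs0, not_lt.1 h⟩
      have : b - a < s / t := by rw [lt_div_iff₀ ht]; linarith
      rw [Real.sqrt_eq_zero_of_nonpos (mul_nonpos_of_nonpos_of_nonneg (by linarith) hs0.le)]
      simp
    rw [h3, ← intervalIntegral.integral_const_mul]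
    refine intervalIntegral.integral_congr ?_
    intro s _
    simp only
    rw [show (b - (a + s / t)) * (a + s / t - a) = ((b - (a + s / t)) * s) / t by ring,
      Real.sqrt_div' _ ht.le,
      show -v * t * (a + s / t) = -(v * a * t) + -(v * s) by field_simp; ring, Real.exp_add]
    ring
  rw [h2] at h1
  set I := ∫ ξ in a..b, (1 / (2 * π * ξ)) * Real.sqrt ((b - ξ) * (ξ - a)) *
            Real.exp (-v * t * ξ)
  set G := ∫ s in Set.Ioi (0:ℝ),
      1 / (2 * π * (a + s / t)) * Real.sqrt ((b - (a + s / t)) * s) * Real.exp (-(v * s))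
  have he : Real.exp (2 * v * a * t) * Real.exp (-(v * a * t)) ^ 2 = 1 := by
    rw [← Real.exp_nat_mul, ← Real.exp_add]
    simp
    ring
  calc t ^ 3 * Real.exp (2 * v * a * t) * I ^ 2
      = t * Real.exp (2 * v * a * t) * (t * I) ^ 2 := by ring
    _ = (t * ((Real.sqrt t) ^ 2)⁻¹) *
        (Real.exp (2 * v * a * t) * Real.exp (-(v * a * t)) ^ 2) * G ^ 2 := by
        rw [← h1]; ring
    _ = G ^ 2 := by rw [he, Real.sq_sqrt ht.le, mul_inv_cancel₀ ht.ne']; ring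

/-- multiple jump operators: exponential relaxation with `t⁻³` prefactor:
with `ξ_± = (1 ± √m)²` and
`ψ(t) = ∫_{ξ₋}^{ξ₊} (1/(2πξ))√((ξ₊ − ξ)(ξ − ξ₋)) e^{−vtξ} dξ`, one has
`t³ e^{2vξ₋t} ψ(t)² → √m/(4π v³ ξ₋²)` as `t → ∞`; in particular the asymptotic decay rate
is `2v(1 − √m)²`. -/
theorem multi_jump_form_factor_asymptotics (m : ℕ) (hm : 2 ≤ m) (v : ℝ) (hv : 0 < v) :
    Tendsto
      (fun t : ℝ => t ^ 3 * Real.exp (2 * v * (1 - Real.sqrt m) ^ 2 * t) *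
        (∫ ξ in ((1 - Real.sqrt m) ^ 2)..((1 + Real.sqrt m) ^ 2),
          (1 / (2 * π * ξ)) *
            Real.sqrt (((1 + Real.sqrt m) ^ 2 - ξ) * (ξ - (1 - Real.sqrt m) ^ 2)) *
            Real.exp (-v * t * ξ)) ^ 2)
      atTop
      (nhds (Real.sqrt m / (4 * π * v ^ 3 * ((1 - Real.sqrt m) ^ 2) ^ 2))) := by
  have hm1 : (1:ℝ) < Real.sqrt m := by
    rw [Real.lt_sqrt (by norm_num)]
    have : (2:ℝ) ≤ m := by exact_mod_cast hm
    linarith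
  have ha : 0 < (1 - Real.sqrt m) ^ 2 := by
    have : 1 - Real.sqrt m ≠ 0 := by linarith
    positivity
  have hab : (1 - Real.sqrt m) ^ 2 < (1 + Real.sqrt m) ^ 2 := by nlinarith
  have h := (laplace_limit _ _ v ha hab hv).pow 2
  rw [laplace_value _ _ v hab hv] at h
  have hc : ((1 + Real.sqrt m) ^ 2 - (1 - Real.sqrt m) ^ 2) /
      (16 * π * v ^ 3 * ((1 - Real.sqrt m) ^ 2) ^ 2)
      = Real.sqrt m / (4 * π * v ^ 3 * ((1 - Real.sqrt m) ^ 2) ^ 2) := by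
    rw [show (1 + Real.sqrt m) ^ 2 - (1 - Real.sqrt m) ^ 2 = 4 * Real.sqrt m by ring,
      show 16 * π * v ^ 3 * ((1 - Real.sqrt m) ^ 2) ^ 2
        = 4 * (4 * π * v ^ 3 * ((1 - Real.sqrt m) ^ 2) ^ 2) by ring,
      mul_div_mul_left _ _ (by norm_num)]
  rw [hc] at h
  refine h.congr' ?_
  filter_upwards [eventually_gt_atTop 0] with t ht
  exact (laplace_subst _ _ v t hab ht).symm
end

section
/- For γ > 0 define P_γ(x) = 4/(γx) − (1/x − γ/(1 + γx) + 1/γ)² for x > 0; the curve y² = P_γ(x) bounds the support of the eigenvalue density of the random non-Hermitian Hamiltonian H − iγL†L, and the spectral gap x_min(γ) is the smallest positive zero of P_γ. Then: (i) for every γ > 0 there exists a smallest x_min(γ) > 0 with P_γ(x_min(γ)) = 0 and P_γ(x) < 0 for 0 < x < x_min(γ); (ii) lim_{γ→0⁺} x_min(γ)/γ = 1; and (iii) lim_{γ→∞} (4γ)^{1/3} x_min(γ) = 1. In particular the gap scales linearly at weak dissipative coupling and as (4γ)^{−1/3} at strong coupling. -/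
open Filter Set

/-- The boundary-curve function `P_γ(x) = 4/(γx) − (1/x − γ/(1+γx) + 1/γ)²` whose smallest
positive zero is the spectral gap of the random non-Hermitian Hamiltonian `H − iγL†L`. -/
noncomputable def Pcurve (γ x : ℝ) : ℝ :=
  4 / (γ * x) - (1 / x - γ / (1 + γ * x) + 1 / γ) ^ 2


/-- The numerator of `P_γ(γ s²)` up to a positive factor. -/
noncomputable def gapG (γ s : ℝ) : ℝ := (2 - s) * γ ^ 2 * s ^ 3 - (1 - s) ^ 2

lemma Pcurve_factor (γ s : ℝ) (hγ : 0 < γ) (hs : 0 < s) :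
    ∃ C : ℝ, 0 < C ∧ Pcurve γ (γ * s ^ 2) = gapG γ s * C := by
  refine ⟨1 / (1 + γ ^ 2 * s ^ 2) * (1 / γ ^ 2) * (1 / s ^ 2) *
    (2 / s + (1 / (s ^ 2 * (1 + γ ^ 2 * s ^ 2)) + 1)), by positivity, ?_⟩
  have h1 : 1 + γ ^ 2 * s ^ 2 ≠ 0 := by positivity
  have h2 : 1 + γ * (γ * s ^ 2) ≠ 0 := by positivity
  have h3 : 1 + γ * (γ * s ^ 2) = 1 + γ ^ 2 * s ^ 2 := by ring
  unfold Pcurve gapG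
  rw [h3]
  field_simp
  ring

lemma gapG_mono (γ a b : ℝ) (ha : 0 < a) (hab : a < b) (hb : b ≤ 1) :
    gapG γ a < gapG γ b := by
  unfold gapG
  have h1 : (2 - a) * a ^ 3 ≤ (2 - b) * b ^ 3 := by
    have e : (2 - b) * b ^ 3 - (2 - a) * a ^ 3 = (b - a) *
      ((2 - a - b) * (b ^ 2 + a ^ 2) + 2 * (a * b)) := by ring
    have : 0 ≤ (b - a) * ((2 - a - b) * (b ^ 2 + a ^ 2) + 2 * (a * b)) := by
      apply mul_nonneg (by linarith)
      have : 0 ≤ 2 - a - b := by linarith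
      have : 0 < b := by linarith
      positivity
    linarith
  have h2 : (1 - b) ^ 2 < (1 - a) ^ 2 := by nlinarith
  have h3 := mul_le_mul_of_nonneg_left h1 (sq_nonneg γ)
  nlinarith

lemma param (γ x : ℝ) (hγ : 0 < γ) (hx : 0 < x) :
    ∃ s, 0 < s ∧ x = γ * s ^ 2 := by
  refine ⟨√(x / γ), by positivity, ?_⟩
  rw [Real.sq_sqrt (by positivity)]
  field_simp

lemma gap_exists (γ : ℝ) (hγ : 0 < γ) : ∃ x₀ : ℝ, 0 < x₀ ∧ Pcurve γ x₀ = 0 ∧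
      ∀ x : ℝ, 0 < x → x < x₀ → Pcurve γ x < 0 := by
  have hc : ContinuousOn (gapG γ) (Icc 0 1) := by
    unfold gapG; fun_prop
  have := intermediate_value_Icc (zero_le_one) hc
  have h0 : (0 : ℝ) ∈ Icc (gapG γ 0) (gapG γ 1) := by
    constructor
    · simp [gapG]
    · simp only [gapG]; nlinarith [sq_nonneg γ]
  obtain ⟨s, ⟨hs0, hs1⟩, hs⟩ := this h0
  have hs0' : 0 < s := by
    rcases hs0.lt_or_eq with h | h
    · exact h
    · subst h; simp [gapG] at hs
  refine ⟨γ * s ^ 2, by positivity, ?_, ?_⟩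
  · obtain ⟨C, _, h⟩ := Pcurve_factor γ s hγ hs0'
    rw [h, hs, zero_mul]
  · intro x hx hlt
    obtain ⟨t, ht, rfl⟩ := param γ x hγ hx
    obtain ⟨C, hC, h⟩ := Pcurve_factor γ t hγ ht
    rw [h]
    have hts : t < s := by
      have := lt_of_mul_lt_mul_left hlt hγ.le
      exact lt_of_pow_lt_pow_left₀ 2 hs0 this
    have := gapG_mono γ t s ht hts hs1
    rw [hs] at this
    exact mul_neg_of_neg_of_pos this hC

lemma gap_param (γ x₀ : ℝ) (hγ : 0 < γ) (hx : 0 < x₀) (h0 : Pcurve γ x₀ = 0)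
    (hneg : ∀ x : ℝ, 0 < x → x < x₀ → Pcurve γ x < 0) :
    ∃ s, 0 < s ∧ s ≤ 1 ∧ x₀ = γ * s ^ 2 ∧ (2 - s) * γ ^ 2 * s ^ 3 = (1 - s) ^ 2 := by
  obtain ⟨s, hs, rfl⟩ := param γ x₀ hγ hx
  refine ⟨s, hs, ?_, rfl, ?_⟩
  · by_contra! h
    have h1 := hneg (γ * 1 ^ 2) (by positivity) (by gcongr)
    obtain ⟨C, hC, h2⟩ := Pcurve_factor γ 1 hγ one_pos
    rw [h2] at h1
    have : 0 < gapG γ 1 := by simp only [gapG]; ring_nf; positivity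
    nlinarith [mul_pos this hC]
  · obtain ⟨C, hC, h2⟩ := Pcurve_factor γ s hγ hs
    rw [h2] at h0
    have := (mul_eq_zero.1 h0).resolve_right hC.ne'
    unfold gapG at this
    linarith

/-- (i) for every `γ > 0` the function `P_γ` has a smallest positive zero
`x_min(γ)` (with `P_γ < 0` below it); (ii) `x_min(γ)/γ → 1` as `γ → 0⁺`; and (iii)
`(4γ)^{1/3} x_min(γ) → 1` as `γ → ∞`. -/
theorem spectral_gap_scaling :
    (∀ γ : ℝ, 0 < γ → ∃ x₀ : ℝ, 0 < x₀ ∧ Pcurve γ x₀ = 0 ∧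
      ∀ x : ℝ, 0 < x → x < x₀ → Pcurve γ x < 0) ∧
    ∀ xmin : ℝ → ℝ,
      (∀ γ : ℝ, 0 < γ → 0 < xmin γ ∧ Pcurve γ (xmin γ) = 0 ∧
        ∀ x : ℝ, 0 < x → x < xmin γ → Pcurve γ x < 0) →
      Tendsto (fun γ : ℝ => xmin γ / γ) (nhdsWithin 0 (Ioi 0)) (nhds 1) ∧
      Tendsto (fun γ : ℝ => (4 * γ) ^ ((1 : ℝ) / 3) * xmin γ) atTop (nhds 1) := by
  refine ⟨gap_exists, ?_⟩
  intro xmin hx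
  have key : ∀ γ : ℝ, ∃ s, 0 < γ → 0 < s ∧ s ≤ 1 ∧ xmin γ = γ * s ^ 2 ∧
      (2 - s) * γ ^ 2 * s ^ 3 = (1 - s) ^ 2 := by
    intro γ
    by_cases hγ : 0 < γ
    · obtain ⟨h1, h2, h3⟩ := hx γ hγ
      obtain ⟨s, hs⟩ := gap_param γ _ hγ h1 h2 h3
      exact ⟨s, fun _ => hs⟩
    · exact ⟨0, fun h => absurd h hγ⟩
  choose s hs using key
  constructor
  · have hlim : Tendsto s (nhdsWithin 0 (Ioi 0)) (nhds 1) := by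
      have hl : Tendsto (fun γ : ℝ => 1 - γ) (nhdsWithin 0 (Ioi 0)) (nhds 1) := by
        have : Tendsto (fun γ : ℝ => 1 - γ) (nhds 0) (nhds (1 - 0)) :=
          (continuous_const.sub continuous_id).tendsto 0
        rw [sub_zero] at this
        exact this.mono_left nhdsWithin_le_nhds
      refine tendsto_of_tendsto_of_tendsto_of_le_of_le' hl tendsto_const_nhds ?_ ?_
      · filter_upwards [self_mem_nhdsWithin] with γ hγ
        have hγ : 0 < γ := hγ
        obtain ⟨h1, h2, h3, h4⟩ := hs γ hγ
        have h5 : (2 - s γ) * s γ ^ 3 ≤ 1 := by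
          have e : 1 - (2 - s γ) * s γ ^ 3 = (1 - s γ) *
            (1 + s γ + s γ ^ 2 * (1 - s γ)) := by ring
          have : 0 ≤ 1 - s γ := by linarith
          have : 0 ≤ (1 - s γ) * (1 + s γ + s γ ^ 2 * (1 - s γ)) := by positivity
          linarith
        have h6 : (1 - s γ) ^ 2 ≤ γ ^ 2 := by nlinarith [sq_nonneg γ]
        have := abs_le_of_sq_le_sq h6 hγ.le
        linarith [(abs_le.1 this).2]
      · filter_upwards [self_mem_nhdsWithin] with γ hγ
        exact (hs γ hγ).2.1
    have h2 := hlim.pow 2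
    rw [one_pow] at h2
    refine h2.congr' ?_
    filter_upwards [self_mem_nhdsWithin] with γ hγ
    have hγ : 0 < γ := hγ
    rw [(hs γ hγ).2.2.1]
    field_simp
  · have h3lim : Tendsto (fun γ => s γ ^ 3) atTop (nhds 0) := by
      have hu : Tendsto (fun γ : ℝ => (γ ^ 2)⁻¹) atTop (nhds 0) :=
        tendsto_inv_atTop_zero.comp (tendsto_pow_atTop two_ne_zero)
      refine tendsto_of_tendsto_of_tendsto_of_le_of_le' tendsto_const_nhds hu ?_ ?_
      · filter_upwards [eventually_gt_atTop 0] with γ hγ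
        have := (hs γ hγ).1
        positivity
      · filter_upwards [eventually_gt_atTop 0] with γ hγ
        obtain ⟨h1, h2, h3, h4⟩ := hs γ hγ
        rw [← one_div, le_div_iff₀ (by positivity)]
        have : 0 ≤ (1 - s γ) * (γ ^ 2 * s γ ^ 3) :=
          mul_nonneg (by linarith) (by positivity)
        nlinarith
    have hlim : Tendsto s atTop (nhds 0) := by
      have := h3lim.rpow_const (p := (1 : ℝ) / 3) (Or.inr (by norm_num))
      rw [Real.zero_rpow (by norm_num)] at this
      refine this.congr' ?_
      filter_upwards [eventually_gt_atTop 0] with γ hγ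
      have h1 := (hs γ hγ).1
      rw [← Real.rpow_natCast, ← Real.rpow_mul h1.le]
      norm_num
    have hF : ContinuousAt (fun t : ℝ => ((2 * (1 - t) ^ 2 / (2 - t)) ^ 2) ^ ((1 : ℝ) / 3)) 0 := by
      refine ContinuousAt.rpow_const ?_ (Or.inr (by norm_num))
      exact (ContinuousAt.div (by fun_prop) (by fun_prop) (by norm_num)).pow 2
    have h := hF.tendsto.comp hlim
    have e : ((2 * (1 - (0 : ℝ)) ^ 2 / (2 - 0)) ^ 2) ^ ((1 : ℝ) / 3) = 1 := by norm_num
    rw [e] at h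
    refine h.congr' ?_
    filter_upwards [eventually_gt_atTop 0] with γ hγ
    obtain ⟨h1, h2, h3, h4⟩ := hs γ hγ
    have hx0 : 0 < xmin γ := (hx γ hγ).1
    have hc : xmin γ = (xmin γ ^ 3) ^ ((1 : ℝ) / 3) := by
      rw [← Real.rpow_natCast, ← Real.rpow_mul hx0.le]
      norm_num
    rw [hc, ← Real.mul_rpow (by positivity) (by positivity)]
    simp only [Function.comp]
    congr 1
    rw [← h4, h3]
    have : 2 - s γ ≠ 0 := by linarith
    field_simp
    ring
end
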